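/- For the discrete-time memoryless Gaussian channel Y = √snr·X + Z, where Z is a standard normal random variable independent of X and E[X²] < ∞, the mutual information between X and Y, viewed as a function of snr > 0, is differentiable and satisfies d/d(snr) I(X;Y) = (1/2)·E[(X − E[X|Y])²]. -/

import Mathlib

open MeasureTheory ProbabilityTheory Real

/-- The mutual information `I(X; Y)` between two random variables, defined as the
expectation of the log of the Radon–Nikodym derivative of the joint law with respect to
the product of the marginal laws. -/
noncomputable def mutualInfo {Ω α β : Type*} [MeasurableSpace Ω] [MeasurableSpace α]
    [MeasurableSpace β] (P : Measure Ω) (X : Ω → α) (Y : Ω → β) : ℝ :=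
  ∫ ω, Real.log ((Measure.rnDeriv (P.map (fun ω => (X ω, Y ω)))
      ((P.map X).prod (P.map Y)) (X ω, Y ω)).toReal) ∂P

/-- The density at `y` of `a * X + Z`, for `X` of law `μ` and `Z` standard normal, up to the
factor `√(2π)`. -/
noncomputable def channelDensity (μ : Measure ℝ) (a y : ℝ) : ℝ :=
  ∫ x, exp (-(y - a * x) ^ 2 / 2) ∂μ

/-- The mean of `f` under the posterior law of `X` given `a * X + Z = y`. -/
noncomputable def posteriorMean (μ : Measure ℝ) (a : ℝ) (f : ℝ → ℝ) (y : ℝ) : ℝ :=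
  (∫ x, f x * exp (-(y - a * x) ^ 2 / 2) ∂μ) / channelDensity μ a y

section channelDensity

variable (μ : Measure ℝ)

lemma exp_neg_sq_half_le_one (w : ℝ) : exp (-w ^ 2 / 2) ≤ 1 :=
  exp_le_one_iff.2 (by nlinarith [sq_nonneg w])

lemma integrable_mul_gaussian_kernel {f : ℝ → ℝ} (hf : Integrable f μ) (a y : ℝ) :
    Integrable (fun x => f x * exp (-(y - a * x) ^ 2 / 2)) μ := by
  refine hf.mono (hf.1.mul (by fun_prop)) (ae_of_all _ fun x => ?_)
  rw [norm_mul, norm_of_nonneg (exp_pos _).le]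
  exact mul_le_of_le_one_right (norm_nonneg _) (exp_neg_sq_half_le_one _)

variable [IsProbabilityMeasure μ]

lemma integrable_gaussian_kernel (a y : ℝ) :
    Integrable (fun x => exp (-(y - a * x) ^ 2 / 2)) μ := by
  simpa using integrable_mul_gaussian_kernel μ (integrable_const (1 : ℝ)) a y

lemma channelDensity_pos (a y : ℝ) : 0 < channelDensity μ a y := by
  refine (integral_pos_iff_support_of_nonneg (fun x => (exp_pos _).le)
    (integrable_gaussian_kernel μ a y)).2 ?_
  simp [Function.support, exp_ne_zero]

lemma channelDensity_le_one (a y : ℝ) : channelDensity μ a y ≤ 1 := by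
  calc channelDensity μ a y ≤ ∫ _, (1 : ℝ) ∂μ :=
        integral_mono (integrable_gaussian_kernel μ a y) (integrable_const _)
          fun x => exp_neg_sq_half_le_one _
    _ = 1 := by simp

lemma neg_log_channelDensity_le (hμ : Integrable (fun x => x ^ 2) μ) (a y : ℝ) :
    -log (channelDensity μ a y) ≤ y ^ 2 + a ^ 2 * ∫ x, x ^ 2 ∂μ := by
  set c := y ^ 2 + a ^ 2 * ∫ x, x ^ 2 ∂μ with hc
  have hint : Integrable (fun x => exp (-c) * (1 + c - (y ^ 2 + a ^ 2 * x ^ 2))) μ :=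
    ((integrable_const _).sub ((integrable_const _).add (hμ.const_mul _))).const_mul _
  have hle : exp (-c) ≤ channelDensity μ a y := by
    calc exp (-c) = ∫ x, exp (-c) * (1 + c - (y ^ 2 + a ^ 2 * x ^ 2)) ∂μ := by
          have hquad : Integrable (fun x => y ^ 2 + a ^ 2 * x ^ 2) μ :=
            (integrable_const _).add (hμ.const_mul _)
          rw [integral_const_mul, integral_sub (integrable_const _) hquad,
            integral_add (integrable_const _) (hμ.const_mul _), integral_const_mul]
          simp [← hc]
      _ ≤ channelDensity μ a y := by
          refine integral_mono hint (integrable_gaussian_kernel μ a y) fun x => ?_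
          calc exp (-c) * (1 + c - (y ^ 2 + a ^ 2 * x ^ 2))
              ≤ exp (-c) * exp (c - (y ^ 2 + a ^ 2 * x ^ 2)) := by
                gcongr
                linarith [add_one_le_exp (c - (y ^ 2 + a ^ 2 * x ^ 2))]
            _ = exp (-(y ^ 2 + a ^ 2 * x ^ 2)) := by rw [← exp_add]; ring_nf
            _ ≤ exp (-(y - a * x) ^ 2 / 2) :=
                exp_le_exp.2 (by nlinarith [sq_nonneg (y + a * x)])
  have := log_le_log (exp_pos _) hle
  rw [log_exp] at this
  linarith

lemma abs_log_channelDensity_le (hμ : Integrable (fun x => x ^ 2) μ) (a y : ℝ) :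
    |log (channelDensity μ a y)| ≤ y ^ 2 + a ^ 2 * ∫ x, x ^ 2 ∂μ := by
  rw [abs_of_nonpos (log_nonpos (channelDensity_pos μ a y).le (channelDensity_le_one μ a y))]
  exact neg_log_channelDensity_le μ hμ a y

lemma stronglyMeasurable_integral_kernel {f : ℝ → ℝ} (hf : Measurable f) (a : ℝ) :
    StronglyMeasurable fun y => ∫ x, f x * exp (-(y - a * x) ^ 2 / 2) ∂μ := by
  refine StronglyMeasurable.integral_prod_right (Measurable.stronglyMeasurable ?_)
  unfold Function.uncurry
  fun_prop

lemma measurable_channelDensity (a : ℝ) : Measurable (channelDensity μ a) := by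
  simpa [← channelDensity.eq_def] using
    (stronglyMeasurable_integral_kernel μ (measurable_const (a := (1 : ℝ))) a).measurable

lemma measurable_posteriorMean {f : ℝ → ℝ} (hf : Measurable f) (a : ℝ) :
    Measurable (posteriorMean μ a f) :=
  (stronglyMeasurable_integral_kernel μ hf a).measurable.div (measurable_channelDensity μ a)

/-- The posterior second moment of the noise is at most logarithmic in the density. -/
lemma integral_sq_mul_kernel_le (a y : ℝ) :
    ∫ x, (y - a * x) ^ 2 * exp (-(y - a * x) ^ 2 / 2) ∂μ
      ≤ (4 - 4 * log (channelDensity μ a y)) * channelDensity μ a y := by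
  set G := channelDensity μ a y
  have hGpos : 0 < G := channelDensity_pos μ a y
  have hker := integrable_gaussian_kernel μ a y
  have hpt : ∀ x, (y - a * x) ^ 2 * exp (-(y - a * x) ^ 2 / 2)
      ≤ -4 * log G * exp (-(y - a * x) ^ 2 / 2) + 4 * G := fun x => by
    have h1 : (y - a * x) ^ 2 + 4 * log G ≤ 4 * (G * exp ((y - a * x) ^ 2 / 4)) := by
      have := add_one_le_exp (log G + (y - a * x) ^ 2 / 4)
      rw [exp_add, exp_log hGpos] at this
      linarith
    have h2 : exp ((y - a * x) ^ 2 / 4) * exp (-(y - a * x) ^ 2 / 2) ≤ 1 := by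
      rw [← exp_add]
      exact exp_le_one_iff.2 (by nlinarith [sq_nonneg (y - a * x)])
    have h3 := mul_le_mul_of_nonneg_right h1 (exp_pos (-(y - a * x) ^ 2 / 2)).le
    nlinarith
  calc ∫ x, (y - a * x) ^ 2 * exp (-(y - a * x) ^ 2 / 2) ∂μ
      ≤ ∫ x, (-4 * log G * exp (-(y - a * x) ^ 2 / 2) + 4 * G) ∂μ :=
        integral_mono_of_nonneg (ae_of_all _ fun x => by positivity)
          ((hker.const_mul _).add (integrable_const _)) (ae_of_all _ hpt)
    _ = (4 - 4 * log G) * G := by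
        rw [integral_add (hker.const_mul _) (integrable_const _), integral_const_mul]
        change -4 * log G * G + _ = _
        simp
        ring

lemma lintegral_gaussian_kernel (a y : ℝ) :
    ∫⁻ x, ENNReal.ofReal (exp (-(y - a * x) ^ 2 / 2)) ∂μ
      = ENNReal.ofReal (channelDensity μ a y) :=
  (ofReal_integral_eq_lintegral_ofReal (integrable_gaussian_kernel μ a y)
    (ae_of_all _ fun _ => (exp_pos _).le)).symm

end channelDensity

section channel

variable {Ω : Type*} [MeasurableSpace Ω] {P : Measure Ω} [IsProbabilityMeasure P] {X Z : Ω → ℝ}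

lemma lintegral_channel (hX : Measurable X) (hZ : Measurable Z) (hindep : IndepFun X Z P)
    (hZlaw : P.map Z = gaussianReal 0 1) (a : ℝ) {g : ℝ × ℝ → ENNReal} (hg : Measurable g) :
    ∫⁻ ω, g (X ω, a * X ω + Z ω) ∂P
      = ∫⁻ x, ∫⁻ y, ENNReal.ofReal ((√(2 * π))⁻¹) *
          (ENNReal.ofReal (exp (-(y - a * x) ^ 2 / 2)) * g (x, y)) ∂volume ∂(P.map X) := by
  have : IsProbabilityMeasure (P.map X) := Measure.isProbabilityMeasure_map hX.aemeasurable
  calc ∫⁻ ω, g (X ω, a * X ω + Z ω) ∂P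
      = ∫⁻ p, g (p.1, a * p.1 + p.2) ∂(P.map fun ω => (X ω, Z ω)) :=
        (lintegral_map (f := fun p : ℝ × ℝ => g (p.1, a * p.1 + p.2)) (by fun_prop)
          (hX.prodMk hZ)).symm
    _ = ∫⁻ x, ∫⁻ z, g (x, a * x + z) ∂(gaussianReal 0 1) ∂(P.map X) := by
        rw [(indepFun_iff_map_prod_eq_prod_map_map hX.aemeasurable hZ.aemeasurable).1 hindep,
          hZlaw, lintegral_prod _ (by fun_prop)]
    _ = _ := by
        refine lintegral_congr fun x => ?_
        rw [gaussianReal_of_var_ne_zero _ one_ne_zero, lintegral_withDensity_eq_lintegral_mul _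
          (measurable_gaussianPDF 0 1) (by fun_prop),
          ← lintegral_sub_right_eq_self _ (a * x)]
        refine lintegral_congr fun y => ?_
        simp only [Pi.mul_apply, gaussianPDF, gaussianPDFReal, NNReal.coe_one, mul_one, sub_zero,
          add_sub_cancel]
        rw [ENNReal.ofReal_mul (by positivity), mul_assoc]

lemma map_channel_eq_withDensity (hX : Measurable X) (hZ : Measurable Z) (hindep : IndepFun X Z P)
    (hZlaw : P.map Z = gaussianReal 0 1) (a : ℝ) :
    P.map (fun ω => a * X ω + Z ω) = volume.withDensity fun y =>
      ENNReal.ofReal ((√(2 * π))⁻¹) * ENNReal.ofReal (channelDensity (P.map X) a y) := by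
  have : IsProbabilityMeasure (P.map X) := Measure.isProbabilityMeasure_map hX.aemeasurable
  have hm := measurable_channelDensity (P.map X) a
  refine Measure.ext_of_lintegral _ fun g hg => ?_
  rw [lintegral_map hg (by fun_prop), lintegral_channel hX hZ hindep hZlaw a
    (g := fun p => g p.2) (by fun_prop), lintegral_lintegral_swap (by fun_prop),
    lintegral_withDensity_eq_lintegral_mul _ (by fun_prop) hg]
  refine lintegral_congr fun y => ?_
  rw [lintegral_const_mul _ (by fun_prop), lintegral_mul_const (g y) (by fun_prop),
    lintegral_gaussian_kernel, Pi.mul_apply, mul_assoc]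

/-- The density of the joint law of `X` and `a * X + Z` with respect to the product of the
marginals. -/
lemma map_prod_channel_eq_withDensity (hX : Measurable X) (hZ : Measurable Z)
    (hindep : IndepFun X Z P) (hZlaw : P.map Z = gaussianReal 0 1) (a : ℝ) :
    P.map (fun ω => (X ω, a * X ω + Z ω))
      = ((P.map X).prod (P.map fun ω => a * X ω + Z ω)).withDensity fun p =>
        ENNReal.ofReal (exp (-(p.2 - a * p.1) ^ 2 / 2) / channelDensity (P.map X) a p.2) := by
  have : IsProbabilityMeasure (P.map X) := Measure.isProbabilityMeasure_map hX.aemeasurable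
  have hm := measurable_channelDensity (P.map X) a
  have : IsProbabilityMeasure (P.map fun ω => a * X ω + Z ω) :=
    Measure.isProbabilityMeasure_map (by fun_prop)
  refine Measure.ext_of_lintegral _ fun g hg => ?_
  rw [lintegral_map hg (by fun_prop), lintegral_channel hX hZ hindep hZlaw a hg,
    lintegral_withDensity_eq_lintegral_mul _ (by fun_prop) hg, lintegral_prod _ (by fun_prop)]
  refine lintegral_congr fun x => ?_
  rw [map_channel_eq_withDensity hX hZ hindep hZlaw a,
    lintegral_withDensity_eq_lintegral_mul _ (by fun_prop) (by fun_prop)]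
  refine lintegral_congr fun y => ?_
  have hpos := channelDensity_pos (P.map X) a y
  simp only [Pi.mul_apply]
  rw [mul_assoc, ← mul_assoc (ENNReal.ofReal (channelDensity (P.map X) a y)),
    ← ENNReal.ofReal_mul hpos.le, mul_div_cancel₀ _ hpos.ne']

lemma mutualInfo_channel (hX : Measurable X) (hZ : Measurable Z)
    (hindep : IndepFun X Z P) (hZlaw : P.map Z = gaussianReal 0 1) (a : ℝ) :
    mutualInfo P X (fun ω => a * X ω + Z ω)
      = ∫ ω, (-(Z ω) ^ 2 / 2 - log (channelDensity (P.map X) a (a * X ω + Z ω))) ∂P := by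
  have : IsProbabilityMeasure (P.map X) := Measure.isProbabilityMeasure_map hX.aemeasurable
  have hm := measurable_channelDensity (P.map X) a
  have : IsProbabilityMeasure (P.map fun ω => a * X ω + Z ω) :=
    Measure.isProbabilityMeasure_map (by fun_prop)
  have hJ := map_prod_channel_eq_withDensity hX hZ hindep hZlaw a
  have hae := Measure.rnDeriv_withDensity ((P.map X).prod (P.map fun ω => a * X ω + Z ω))
    (f := fun p => ENNReal.ofReal
      (exp (-(p.2 - a * p.1) ^ 2 / 2) / channelDensity (P.map X) a p.2)) (by fun_prop)
  rw [← hJ] at hae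
  have hac : P.map (fun ω => (X ω, a * X ω + Z ω))
      ≪ (P.map X).prod (P.map fun ω => a * X ω + Z ω) := by
    rw [hJ]
    exact withDensity_absolutelyContinuous _ _
  refine integral_congr_ae ?_
  filter_upwards [ae_of_ae_map (by fun_prop) (hac.ae_le hae)] with ω hω
  have hpos := channelDensity_pos (P.map X) a (a * X ω + Z ω)
  rw [hω, ENNReal.toReal_ofReal (by positivity), log_div (exp_ne_zero _) hpos.ne', log_exp]
  simp

/-- Bayes' formula for the Gaussian channel. -/
lemma condExp_channel (hX : Measurable X) (hZ : Measurable Z)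
    (hindep : IndepFun X Z P) (hZlaw : P.map Z = gaussianReal 0 1) (a : ℝ) {f : ℝ → ℝ}
    (hf : Measurable f) (hfX : Integrable (fun ω => f (X ω)) P) :
    (fun ω => posteriorMean (P.map X) a f (a * X ω + Z ω)) =ᵐ[P]
      P[fun ω => f (X ω) | MeasurableSpace.comap (fun ω => a * X ω + Z ω) inferInstance] := by
  have : IsProbabilityMeasure (P.map X) := Measure.isProbabilityMeasure_map hX.aemeasurable
  have hm := measurable_channelDensity (P.map X) a
  have hY : Measurable fun ω => a * X ω + Z ω := by fun_prop
  have : IsProbabilityMeasure (P.map fun ω => a * X ω + Z ω) :=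
    Measure.isProbabilityMeasure_map (by fun_prop)
  set ν := P.map fun ω => a * X ω + Z ω
  set r : ℝ × ℝ → ℝ := fun p => exp (-(p.2 - a * p.1) ^ 2 / 2) / channelDensity (P.map X) a p.2
    with hr
  have hJ : P.map (fun ω => (X ω, a * X ω + Z ω))
      = ((P.map X).prod ν).withDensity fun p => ENNReal.ofReal (r p) :=
    map_prod_channel_eq_withDensity hX hZ hindep hZlaw a
  have hr0 : ∀ p, 0 ≤ r p := fun p => div_nonneg (exp_pos _).le (channelDensity_pos _ _ _).le
  have hrm : Measurable r := by fun_prop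
  have hmean : ∀ y, ∫ x, r (x, y) * f x ∂(P.map X) = posteriorMean (P.map X) a f y := fun y => by
    rw [posteriorMean, ← integral_div]
    exact integral_congr_ae (ae_of_all _ fun x => by simp only [hr]; ring)
  have hint : Integrable (fun p : ℝ × ℝ => r p * f p.1) ((P.map X).prod ν) := by
    have h1 : Integrable (fun p : ℝ × ℝ => f p.1) (P.map fun ω => (X ω, a * X ω + Z ω)) :=
      (integrable_map_measure (hf.comp measurable_fst).aestronglyMeasurable (by fun_prop)).2 hfX
    rw [hJ, integrable_withDensity_iff_integrable_smul' (by fun_prop) (by simp)] at h1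
    simpa only [ENNReal.toReal_ofReal (hr0 _), smul_eq_mul] using h1
  have hpint : Integrable (fun ω => posteriorMean (P.map X) a f (a * X ω + Z ω)) P := by
    have h1 := hint.integral_prod_right
    simp only [hmean] at h1
    exact h1.comp_measurable hY
  refine ae_eq_condExp_of_forall_setIntegral_eq hY.comap_le hfX (fun s _ _ => hpint.integrableOn)
    ?_ ?_
  · rintro _ ⟨B, hB, rfl⟩ -
    rw [← integral_indicator (hY hB), ← integral_indicator (hY hB)]
    have hL : ∫ ω, ((fun ω => a * X ω + Z ω) ⁻¹' B).indicator
        (fun ω => posteriorMean (P.map X) a f (a * X ω + Z ω)) ω ∂P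
        = ∫ y, B.indicator (posteriorMean (P.map X) a f) y ∂ν :=
      (integral_map hY.aemeasurable
        ((measurable_posteriorMean _ hf a).indicator hB).aestronglyMeasurable).symm
    have hR : ∫ ω, ((fun ω => a * X ω + Z ω) ⁻¹' B).indicator (fun ω => f (X ω)) ω ∂P
        = ∫ p, (Prod.snd ⁻¹' B).indicator (fun p : ℝ × ℝ => f p.1) p
          ∂(P.map fun ω => (X ω, a * X ω + Z ω)) :=
      (integral_map (hX.prodMk hY).aemeasurable (Measurable.indicator (hf.comp measurable_fst)
        (measurable_snd hB)).aestronglyMeasurable).symm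
    have hind : ∀ p : ℝ × ℝ, r p * (Prod.snd ⁻¹' B).indicator (fun p : ℝ × ℝ => f p.1) p
        = (Prod.snd ⁻¹' B).indicator (fun p : ℝ × ℝ => r p * f p.1) p := fun p => by
      by_cases hp : p ∈ (Prod.snd ⁻¹' B : Set (ℝ × ℝ)) <;> simp [hp]
    rw [hL, hR, hJ, integral_withDensity_eq_integral_toReal_smul (by fun_prop) (by simp)]
    simp only [ENNReal.toReal_ofReal (hr0 _), smul_eq_mul, hind]
    rw [integral_prod_symm _ (hint.indicator (measurable_snd hB))]
    refine integral_congr_ae (ae_of_all _ fun y => ?_)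
    by_cases hy : y ∈ B <;> simp [hy, Set.indicator, hmean]
  · exact ((measurable_posteriorMean _ hf a).comp
      (comap_measurable _)).stronglyMeasurable.aestronglyMeasurable

end channel

section derivative

lemma integral_mul_condExp {Ω : Type*} {m : MeasurableSpace Ω} {m₀ : MeasurableSpace Ω} {P : Measure Ω}
    [IsFiniteMeasure P] (hm : m ≤ m₀) {U V : Ω → ℝ} (hU : StronglyMeasurable[m] U)
    (hU2 : MemLp U 2 P) (hV2 : MemLp V 2 P) :
    ∫ ω, U ω * (P[V | m]) ω ∂P = ∫ ω, U ω * V ω ∂P := by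
  rw [← integral_condExp hm (f := fun ω => U ω * V ω)]
  exact integral_congr_ae (condExp_mul_of_stronglyMeasurable_left hU (hU2.integrable_mul hV2)
    (hV2.integrable one_le_two)).symm

lemma posteriorMean_score (μ : Measure ℝ) [IsProbabilityMeasure μ] (hμ1 : Integrable (fun x => x) μ)
    (hμ : Integrable (fun x => x ^ 2) μ) (a x y : ℝ) :
    posteriorMean μ a (fun t => (x - t) * (y - a * t)) y
      = x * y - (y + a * x) * posteriorMean μ a (fun t => t) y
        + a * posteriorMean μ a (fun t => t ^ 2) y := by
  have hpos := channelDensity_pos μ a y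
  have h0 := integrable_gaussian_kernel μ a y
  have h1 := integrable_mul_gaussian_kernel μ hμ1 a y
  have h2 := integrable_mul_gaussian_kernel μ hμ a y
  have key : ∫ t, (x - t) * (y - a * t) * exp (-(y - a * t) ^ 2 / 2) ∂μ
      = x * y * channelDensity μ a y - (y + a * x) * ∫ t, t * exp (-(y - a * t) ^ 2 / 2) ∂μ
        + a * ∫ t, t ^ 2 * exp (-(y - a * t) ^ 2 / 2) ∂μ := by
    rw [channelDensity, ← integral_const_mul, ← integral_const_mul, ← integral_const_mul,
      ← integral_sub (h0.const_mul _) (h1.const_mul _),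
      ← integral_add (by exact (h0.const_mul _).sub (h1.const_mul _)) (h2.const_mul _)]
    exact integral_congr_ae (ae_of_all _ fun t => by ring)
  rw [posteriorMean, posteriorMean, posteriorMean, key]
  field_simp

lemma abs_posteriorMean_score_le (μ : Measure ℝ) [IsProbabilityMeasure μ]
    (hμ : Integrable (fun x => x ^ 2) μ) {a : ℝ} (ha : 0 < a) (x z : ℝ) :
    |posteriorMean μ a (fun t => (x - t) * (a * x + z - a * t)) (a * x + z)|
      ≤ (8 + 8 * ((a * x + z) ^ 2 + a ^ 2 * ∫ x, x ^ 2 ∂μ) + z ^ 2) / a := by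
  set y := a * x + z with hy
  set M := y ^ 2 + a ^ 2 * ∫ x, x ^ 2 ∂μ
  have hpos := channelDensity_pos μ a y
  have hμ1 : Integrable (fun x => x) μ :=
    ((memLp_two_iff_integrable_sq (by fun_prop)).2 hμ).integrable one_le_two
  have hsq : Integrable (fun t => (y - a * t) ^ 2) μ :=
    (((integrable_const (y ^ 2)).sub (hμ1.const_mul (2 * y * a))).add (hμ.const_mul (a ^ 2))).congr
      (ae_of_all _ fun t => by simp only [Pi.add_apply, Pi.sub_apply]; ring)
  have hk0 := integrable_gaussian_kernel μ a y
  have hk2 := integrable_mul_gaussian_kernel μ hsq a y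
  have hpt : ∀ t, ‖(x - t) * (y - a * t) * exp (-(y - a * t) ^ 2 / 2)‖
      ≤ a⁻¹ * (2 * ((y - a * t) ^ 2 * exp (-(y - a * t) ^ 2 / 2))
        + z ^ 2 * exp (-(y - a * t) ^ 2 / 2)) := fun t => by
    have h1 : |(x - t) * (y - a * t)| ≤ a⁻¹ * (2 * (y - a * t) ^ 2 + z ^ 2) := by
      rw [← div_eq_inv_mul, le_div_iff₀ ha, ← abs_of_pos ha, ← abs_mul, abs_of_pos ha, abs_le]
      have : (x - t) * (y - a * t) * a = (y - a * t) ^ 2 - (y - a * t) * z := by rw [hy]; ring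
      rw [this]
      constructor <;> nlinarith [sq_nonneg (y - a * t + z), sq_nonneg (y - a * t - z),
        sq_nonneg (y - a * t)]
    rw [norm_mul, norm_of_nonneg (exp_pos _).le, Real.norm_eq_abs]
    calc _ ≤ _ := mul_le_mul_of_nonneg_right h1 (exp_pos _).le
      _ = _ := by ring
  have hnum : |∫ t, (x - t) * (y - a * t) * exp (-(y - a * t) ^ 2 / 2) ∂μ|
      ≤ a⁻¹ * (2 * ∫ t, (y - a * t) ^ 2 * exp (-(y - a * t) ^ 2 / 2) ∂μ
        + z ^ 2 * channelDensity μ a y) := by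
    refine (norm_integral_le_of_norm_le
      (((hk2.const_mul 2).add (hk0.const_mul (z ^ 2))).const_mul a⁻¹) (ae_of_all _ hpt)).trans_eq ?_
    rw [integral_const_mul, integral_add' (hk2.const_mul 2) (hk0.const_mul (z ^ 2)),
      integral_const_mul, integral_const_mul, channelDensity]
  have h2 := integral_sq_mul_kernel_le μ a y
  have h3 := neg_log_channelDensity_le μ hμ a y
  rw [posteriorMean, abs_div, abs_of_pos hpos, div_le_iff₀ hpos]
  calc _ ≤ _ := hnum
    _ ≤ a⁻¹ * (2 * ((4 + 4 * M) * channelDensity μ a y) + z ^ 2 * channelDensity μ a y) := by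
        gcongr
        refine h2.trans ?_
        gcongr
        linarith
    _ = _ := by ring

lemma hasDerivAt_channelDensity (μ : Measure ℝ) [IsProbabilityMeasure μ]
    (hμ1 : Integrable (fun x => x) μ) (a x z : ℝ) :
    HasDerivAt (fun a => channelDensity μ a (a * x + z))
      (-∫ t, (x - t) * (a * x + z - a * t) * exp (-(a * x + z - a * t) ^ 2 / 2) ∂μ) a := by
  rw [← integral_neg]
  refine (hasDerivAt_integral_of_dominated_loc_of_deriv_le (s := Set.univ)
    (F := fun a t => exp (-(a * x + z - a * t) ^ 2 / 2))
    (F' := fun a t => -((x - t) * (a * x + z - a * t) * exp (-(a * x + z - a * t) ^ 2 / 2)))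
    (bound := fun t => |x - t|) Filter.univ_mem (Filter.Eventually.of_forall fun a => by fun_prop)
    (integrable_gaussian_kernel μ a _) (by fun_prop) (ae_of_all _ fun t b _ => ?_)
    ((integrable_const _).sub hμ1).abs (ae_of_all _ fun t b _ => ?_)).2
  · rw [norm_neg, mul_assoc, norm_mul, Real.norm_eq_abs]
    refine mul_le_of_le_one_right (abs_nonneg _) ?_
    set w := b * x + z - b * t
    rw [norm_mul, norm_of_nonneg (exp_pos _).le, Real.norm_eq_abs]
    have h1 : |w| ≤ exp (w ^ 2 / 2) := by
      have := add_one_le_exp (w ^ 2 / 2)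
      have h2 := sq_abs w
      nlinarith [sq_nonneg (|w| - 1)]
    calc |w| * exp (-w ^ 2 / 2) ≤ exp (w ^ 2 / 2) * exp (-w ^ 2 / 2) := by gcongr
      _ = 1 := by rw [← exp_add]; ring_nf; exact exp_zero
  · have h1 : HasDerivAt (fun a : ℝ => a * x + z - a * t) (x - t) b := by
      exact ((((hasDerivAt_id b).mul_const x).add_const z).fun_sub
        ((hasDerivAt_id b).mul_const t)).congr_deriv (by ring)
    refine ((h1.fun_pow 2).fun_neg.div_const 2).exp.congr_deriv ?_
    push_cast
    ring

variable {Ω : Type*} [MeasurableSpace Ω] {P : Measure Ω} [IsProbabilityMeasure P] {X Z : Ω → ℝ}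

lemma hasDerivAt_integral_log_channelDensity (hX : Measurable X) (hZ : Measurable Z)
    (hX2 : Integrable (fun ω => X ω ^ 2) P) (hZ2 : Integrable (fun ω => Z ω ^ 2) P)
    {a : ℝ} (ha : 0 < a) :
    HasDerivAt (fun a =>
        ∫ ω, (-(Z ω) ^ 2 / 2 - log (channelDensity (P.map X) a (a * X ω + Z ω))) ∂P)
      (∫ ω, posteriorMean (P.map X) a (fun t => (X ω - t) * (a * X ω + Z ω - a * t))
        (a * X ω + Z ω) ∂P) a := by
  have : IsProbabilityMeasure (P.map X) := Measure.isProbabilityMeasure_map hX.aemeasurable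
  have hμ : Integrable (fun x => x ^ 2) (P.map X) :=
    (integrable_map_measure (by fun_prop) (by fun_prop)).2 hX2
  have hμ1 : Integrable (fun x => x) (P.map X) :=
    ((memLp_two_iff_integrable_sq (by fun_prop)).2 hμ).integrable one_le_two
  set M := ∫ x, x ^ 2 ∂(P.map X)
  have hM0 : 0 ≤ M := integral_nonneg fun x => sq_nonneg x
  have hmeas : ∀ b : ℝ, Measurable fun ω =>
      -(Z ω) ^ 2 / 2 - log (channelDensity (P.map X) b (b * X ω + Z ω)) := fun b => by
    have := measurable_channelDensity (P.map X) b
    fun_prop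
  have hsq : ∀ b x z : ℝ, (b * x + z) ^ 2 ≤ 2 * (b ^ 2 * x ^ 2 + z ^ 2) := fun b x z => by
    nlinarith [sq_nonneg (b * x - z)]
  refine (hasDerivAt_integral_of_dominated_loc_of_deriv_le (s := Metric.ball a (a / 2))
    (F' := fun b ω => posteriorMean (P.map X) b (fun t => (X ω - t) * (b * X ω + Z ω - b * t))
        (b * X ω + Z ω))
    (bound := fun ω =>
      (8 + 8 * (2 * ((2 * a) ^ 2 * X ω ^ 2 + Z ω ^ 2) + (2 * a) ^ 2 * M) + Z ω ^ 2) / (a / 2))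
    (Metric.ball_mem_nhds a (half_pos ha))
    (Filter.Eventually.of_forall fun b => (hmeas b).aestronglyMeasurable) ?_ ?_
    (ae_of_all _ fun ω b hb => ?_) ?_ (ae_of_all _ fun ω b hb => ?_)).2
  · refine Integrable.mono' (g := fun ω => Z ω ^ 2 + (2 * (a ^ 2 * X ω ^ 2 + Z ω ^ 2) + a ^ 2 * M))
      (hZ2.add ((((hX2.const_mul _).add hZ2).const_mul _).add (integrable_const _)))
      (hmeas a).aestronglyMeasurable (ae_of_all _ fun ω => ?_)
    refine (norm_sub_le _ _).trans (add_le_add ?_ ?_)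
    · rw [Real.norm_eq_abs, abs_le]
      constructor <;> nlinarith [sq_nonneg (Z ω)]
    · exact (abs_log_channelDensity_le _ hμ a _).trans (by gcongr; exact hsq _ _ _)
  · have h1 := measurable_posteriorMean (P.map X) (f := fun t => t) measurable_id a
    have h2 := measurable_posteriorMean (P.map X) (f := fun t => t ^ 2) (by fun_prop) a
    simp only [posteriorMean_score _ hμ1 hμ]
    exact Measurable.aestronglyMeasurable (by fun_prop)
  · rw [Metric.mem_ball, Real.dist_eq, abs_lt] at hb
    have hb0 : a / 2 < b := by linarith
    have hb1 : b < 2 * a := by linarith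
    have hbpos : 0 < b := by linarith
    refine (abs_posteriorMean_score_le _ hμ hbpos _ _).trans ?_
    gcongr
    refine (hsq _ _ _).trans ?_
    gcongr
  · exact (((integrable_const _).add ((((hX2.const_mul _).add hZ2).const_mul _).add
      (integrable_const _) |>.const_mul _)).add hZ2).div_const _
  · have hpos := channelDensity_pos (P.map X) b (b * X ω + Z ω)
    convert ((hasDerivAt_channelDensity (P.map X) hμ1 b (X ω) (Z ω)).log hpos.ne').const_sub
      (-(Z ω) ^ 2 / 2) using 1
    rw [posteriorMean, neg_div, neg_neg]

/-- The derivative of the mutual information in the channel gain, in terms of the conditional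
mean. -/
lemma integral_posteriorMean_score (hX : Measurable X) (hZ : Measurable Z)
    (hindep : IndepFun X Z P) (hZlaw : P.map Z = gaussianReal 0 1)
    (hX2 : MemLp X 2 P) (hZ2 : MemLp Z 2 P) (a : ℝ) :
    ∫ ω, posteriorMean (P.map X) a (fun t => (X ω - t) * (a * X ω + Z ω - a * t))
        (a * X ω + Z ω) ∂P
      = a * ∫ ω, (X ω -
          (P[X | MeasurableSpace.comap (fun ω => a * X ω + Z ω) inferInstance]) ω) ^ 2 ∂P := by
  have : IsProbabilityMeasure (P.map X) := Measure.isProbabilityMeasure_map hX.aemeasurable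
  have hXsq := hX2.integrable_sq
  have hμ : Integrable (fun x => x ^ 2) (P.map X) :=
    (integrable_map_measure (by fun_prop) (by fun_prop)).2 hXsq
  have hμ1 : Integrable (fun x => x) (P.map X) :=
    ((memLp_two_iff_integrable_sq (by fun_prop)).2 hμ).integrable one_le_two
  have hY : Measurable fun ω => a * X ω + Z ω := by fun_prop
  have hE1 := condExp_channel hX hZ hindep hZlaw a (f := fun t => t) measurable_id
    (hX2.integrable one_le_two)
  have hE2 := condExp_channel hX hZ hindep hZlaw a (f := fun t => t ^ 2) (by fun_prop) hXsq
  have hm := hY.comap_le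
  have hYm : StronglyMeasurable[MeasurableSpace.comap (fun ω => a * X ω + Z ω) inferInstance]
      fun ω => a * X ω + Z ω := (comap_measurable _).stronglyMeasurable
  set Y := fun ω => a * X ω + Z ω
  set V := P[X | MeasurableSpace.comap Y inferInstance]
  set C := P[fun ω => X ω ^ 2 | MeasurableSpace.comap Y inferInstance]
  have hY2 : MemLp Y 2 P := (hX2.const_mul a).add hZ2
  have hV2 : MemLp V 2 P := hX2.condExp one_le_two
  have hYV : ∫ ω, Y ω * V ω ∂P = ∫ ω, Y ω * X ω ∂P := integral_mul_condExp hm hYm hY2 hX2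
  have hVV : ∫ ω, V ω * V ω ∂P = ∫ ω, V ω * X ω ∂P :=
    integral_mul_condExp hm stronglyMeasurable_condExp hV2 hX2
  have hVsq : ∫ ω, C ω ∂P = ∫ ω, X ω ^ 2 ∂P := integral_condExp hm
  have iYX : Integrable (fun ω => Y ω * X ω) P := hY2.integrable_mul hX2
  have iYV : Integrable (fun ω => Y ω * V ω) P := hY2.integrable_mul hV2
  have iVX : Integrable (fun ω => V ω * X ω) P := hV2.integrable_mul hX2
  have iVV : Integrable (fun ω => V ω * V ω) P := hV2.integrable_mul hV2
  have iC : Integrable C P := integrable_condExp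
  have hL : ∫ ω, posteriorMean (P.map X) a (fun t => (X ω - t) * (Y ω - a * t)) (Y ω) ∂P
      = ∫ ω, ((Y ω * X ω - Y ω * V ω)
        + (a * C ω - a * (V ω * X ω))) ∂P := by
    refine integral_congr_ae ?_
    filter_upwards [hE1, hE2] with ω h1 h2
    rw [posteriorMean_score _ hμ1 hμ, h1, h2]
    ring
  have hR : ∫ ω, (X ω - V ω) ^ 2 ∂P
      = ∫ ω, ((X ω ^ 2 - V ω * X ω) + (V ω * V ω - V ω * X ω)) ∂P :=
    integral_congr_ae (ae_of_all _ fun ω => by ring)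
  change ∫ ω, posteriorMean (P.map X) a (fun t => (X ω - t) * (Y ω - a * t)) (Y ω) ∂P = _
  rw [hL, hR, integral_add (by exact iYX.sub iYV) (by exact (iC.const_mul a).sub (iVX.const_mul a)),
    integral_sub iYX iYV, integral_sub (iC.const_mul a) (iVX.const_mul a), integral_const_mul,
    integral_const_mul, integral_add (by exact hXsq.sub iVX) (by exact iVV.sub iVX), integral_sub hXsq iVX,
    integral_sub iVV iVX, hYV, hVV, hVsq]
  ring

end derivative

/-- **I-MMSE relation** (Guo–Shamai–Verdú). For the discrete-time memoryless Gaussian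
channel `Y = √snr · X + Z` with `Z ~ N(0,1)` independent of `X` and `E[X²] < ∞`, the
mutual information `I(X; Y)`, as a function of `snr > 0`, is differentiable with
derivative half the minimum mean-square error `E[(X − E[X|Y])²]`. -/
theorem i_mmse_discrete_memoryless {Ω : Type*} [MeasurableSpace Ω] (P : Measure Ω)
    [IsProbabilityMeasure P] (X Z : Ω → ℝ) (hX : Measurable X) (hZ : Measurable Z)
    (hindep : IndepFun X Z P) (hZlaw : P.map Z = gaussianReal 0 1)
    (hX2 : Integrable (fun ω => (X ω) ^ 2) P)
    (snr : ℝ) (hsnr : 0 < snr) :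
    HasDerivAt (fun s : ℝ => mutualInfo P X (fun ω => Real.sqrt s * X ω + Z ω))
      ((1 / 2) * ∫ ω, (X ω -
          (P[X | MeasurableSpace.comap (fun ω => Real.sqrt snr * X ω + Z ω)
            inferInstance]) ω) ^ 2 ∂P)
      snr := by
  have ha := Real.sqrt_pos.2 hsnr
  have hXL : MemLp X 2 P := (memLp_two_iff_integrable_sq hX.aestronglyMeasurable).2 hX2
  have hZL : MemLp Z 2 P := by
    have := memLp_id_gaussianReal' (μ := 0) (v := 1) 2 ENNReal.ofNat_ne_top
    rw [← hZlaw] at this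
    exact this.comp_measurePreserving (hZ.measurePreserving P)
  have hderiv := hasDerivAt_integral_log_channelDensity hX hZ hX2 hZL.integrable_sq ha
  rw [integral_posteriorMean_score hX hZ hindep hZlaw hXL hZL] at hderiv
  simp only [mutualInfo_channel hX hZ hindep hZlaw]
  refine (hderiv.comp snr (Real.hasDerivAt_sqrt hsnr.ne')).congr_deriv ?_
  field_simp
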